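/- Let d be a natural number with d ≥ 2. There exists a real number x > 0 such that (d − 1)·x < 1/3 and (d(d − 1)/2)·x > (d − 3)/3 if and only if d ≤ 5. -/

import Mathlib

theorem equal_fourth_moments_exist_iff (d : ℕ) (hd : 2 ≤ d) :
    (∃ x : ℝ, 0 < x ∧ ((d : ℝ) - 1) * x < 1/3 ∧
      ((d : ℝ) * ((d : ℝ) - 1) / 2) * x > ((d : ℝ) - 3)/3) ↔ d ≤ 5 := by
  constructor
  · rintro ⟨x, -, hupper, hlower⟩
    have hd_pos : (0 : ℝ) < d := by exact_mod_cast (by omega : 0 < d)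
    have hmul := mul_lt_mul_of_pos_left hupper hd_pos
    have hlt : (d : ℝ) < 6 := by linarith
    have : d < 6 := by exact_mod_cast hlt
    omega
  · intro h
    refine ⟨3 / (10 * ((d : ℝ) - 1)), ?_⟩
    interval_cases d <;> norm_num
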